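/- Let θ > 0, let k ≥ 1, and let p be a symmetric polynomial in k real variables of total degree d. Then there exists a symmetric polynomial q in k real variables of total degree at most d − 1 (with q = 0 if d < 1) such that for every z ∈ ℝ^k with pairwise distinct coordinates, (B₂p)(z) = q(z), where (B₂p)(z) := (1/2) Σ_{i=1}^k z_i ∂²p/∂z_i²(z) + θ Σ_{i=1}^k Σ_{j≠i} (z_i/(z_i−z_j)) ∂p/∂z_i(z). In particular the operator B₂ maps symmetric polynomials to symmetric polynomials, lowering the degree by at least one. -/

import Mathlib

open Finset

/-- First-order partial derivative `∂f/∂z_i (z)`. -/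
noncomputable def pd {m : ℕ} (f : (Fin m → ℝ) → ℝ) (i : Fin m) (z : Fin m → ℝ) : ℝ :=
  fderiv ℝ f z (Pi.single i 1)

/-- Second-order partial derivative `∂²f/∂z_i² (z)`. -/
noncomputable def pd2 {m : ℕ} (f : (Fin m → ℝ) → ℝ) (i : Fin m) (z : Fin m → ℝ) : ℝ :=
  fderiv ℝ (fun w => fderiv ℝ f w (Pi.single i 1)) z (Pi.single i 1)

/-- The lowering operator
`B₂ = (1/2) Σ_i z_i ∂²/∂z_i² + θ Σ_i Σ_{j≠i} (z_i/(z_i-z_j)) ∂/∂z_i`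
from the theory of Jack symmetric polynomials. -/
noncomputable def opB2 {m : ℕ} (θ : ℝ) (f : (Fin m → ℝ) → ℝ) (z : Fin m → ℝ) : ℝ :=
  (1 / 2) * ∑ i, z i * pd2 f i z +
    θ * ∑ i, ∑ j ∈ univ.erase i, (z i / (z i - z j)) * pd f i z

open MvPolynomial in
lemma aux_hasFDeriv {m : ℕ} (P : MvPolynomial (Fin m) ℝ) (z : Fin m → ℝ) :
    DifferentiableAt ℝ (fun w => eval w P) z ∧
    ∀ i, fderiv ℝ (fun w => eval w P) z (Pi.single i 1) = eval z (pderiv i P) := by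
  induction P using MvPolynomial.induction_on with
  | C a => simp
  | add p q hp hq =>
    simp only [map_add]
    refine ⟨hp.1.add hq.1, fun i => ?_⟩
    rw [fderiv_fun_add hp.1 hq.1]
    simp [hp.2, hq.2]
  | mul_X p n hp =>
    simp only [map_mul, eval_X]
    have hx : HasFDerivAt (fun w : Fin m → ℝ => w n)
      (ContinuousLinearMap.proj (R := ℝ) (φ := fun _ : Fin m => ℝ) n) z := hasFDerivAt_apply n z
    refine ⟨hp.1.mul hx.differentiableAt, fun i => ?_⟩
    rw [fderiv_fun_mul hp.1 hx.differentiableAt, hx.fderiv]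
    simp [hp.2, pderiv_X, Pi.single_apply]
    split_ifs <;> simp

open MvPolynomial in
lemma aux_pd {m : ℕ} (P : MvPolynomial (Fin m) ℝ) (i : Fin m) (z : Fin m → ℝ) :
    pd (fun w => eval w P) i z = eval z (pderiv i P) := (aux_hasFDeriv P z).2 i

open MvPolynomial in
lemma aux_pd2 {m : ℕ} (P : MvPolynomial (Fin m) ℝ) (i : Fin m) (z : Fin m → ℝ) :
    pd2 (fun w => eval w P) i z = eval z (pderiv i (pderiv i P)) := by
  unfold pd2
  simp only [(aux_hasFDeriv P _).2]
  exact (aux_hasFDeriv _ z).2 i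

open MvPolynomial in
lemma aux_deg {m : ℕ} (P : MvPolynomial (Fin m) ℝ) (i : Fin m) :
    (pderiv i P).totalDegree ≤ P.totalDegree - 1 := by
  refine Finset.sup_le fun s hs => ?_
  rw [mem_support_iff, coeff_pderiv] at hs
  have h := le_totalDegree (mem_support_iff.2 (left_ne_zero_of_mul hs))
  rw [Finsupp.sum_add_index' (by simp) (by simp), Finsupp.sum_single_index rfl] at h
  omega

open MvPolynomial in
lemma aux_degX {m : ℕ} (P : MvPolynomial (Fin m) ℝ) (i : Fin m) :
    (X i * pderiv i P).totalDegree ≤ P.totalDegree := by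
  by_cases h : P.totalDegree = 0
  · rw [totalDegree_eq_zero_iff_eq_C] at h
    rw [h]; simp
  · have h1 := aux_deg P i
    have h2 := totalDegree_mul (X i) (pderiv i P)
    rw [totalDegree_X] at h2
    omega

open MvPolynomial in
lemma aux_sub_ne {m : ℕ} {i j : Fin m} (h : i ≠ j) :
    (X i - X j : MvPolynomial (Fin m) ℝ) ≠ 0 := fun h0 => h (X_injective (sub_eq_zero.1 h0))

open MvPolynomial in
lemma aux_sub_deg {m : ℕ} {i j : Fin m} (h : i ≠ j) :
    1 ≤ (X i - X j : MvPolynomial (Fin m) ℝ).totalDegree := by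
  by_contra h0
  have h1 : (X i - X j : MvPolynomial (Fin m) ℝ).totalDegree = 0 := by omega
  rw [totalDegree_eq_zero_iff_eq_C] at h1
  have h2 := congrArg (eval (Pi.single i (1:ℝ))) h1
  have h3 := congrArg (eval (0 : Fin m → ℝ)) h1
  simp [h.symm] at h2 h3

open MvPolynomial in
lemma aux_div {m : ℕ} (F : MvPolynomial (Fin m) ℝ) (i j : Fin m) :
    (X i - X j) ∣ F - rename (Equiv.swap i j) F := by
  rw [← Ideal.mem_span_singleton, ← Ideal.Quotient.mk_eq_mk_iff_sub_mem]
  set I := Ideal.span {(X i - X j : MvPolynomial (Fin m) ℝ)}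
  have hX : Ideal.Quotient.mk I (X i) = Ideal.Quotient.mk I (X j) := by
    rw [Ideal.Quotient.mk_eq_mk_iff_sub_mem]; exact Ideal.mem_span_singleton_self _
  have : Ideal.Quotient.mkₐ ℝ I = (Ideal.Quotient.mkₐ ℝ I).comp (rename (Equiv.swap i j)) := by
    apply MvPolynomial.algHom_ext
    intro n
    simp only [AlgHom.comp_apply, rename_X, Ideal.Quotient.mkₐ_eq_mk]
    rw [Equiv.swap_apply_def]
    split_ifs with h1 h2
    · rw [h1, hX]
    · rw [h2, hX]
    · rfl
  exact DFunLike.congr_fun this F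

open MvPolynomial in
lemma aux_D {m : ℕ} (P : MvPolynomial (Fin m) ℝ) (hP : P.IsSymmetric) (i j : Fin m) :
    ∃ D : MvPolynomial (Fin m) ℝ, X i * pderiv i P - X j * pderiv j P = (X i - X j) * D ∧
      (i = j → D = 0) ∧ D.totalDegree ≤ P.totalDegree - 1 := by
  by_cases h : i = j
  · subst h
    exact ⟨0, by simp⟩
  · obtain ⟨D, hD⟩ := aux_div (X i * pderiv i P) i j
    have hr : rename (Equiv.swap i j) (pderiv i P) = pderiv j P := by
      rw [← pderiv_rename (Equiv.swap i j).injective, hP, Equiv.swap_apply_left]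
    rw [map_mul, rename_X, hr, Equiv.swap_apply_left] at hD
    refine ⟨D, hD, fun h' => absurd h' h, ?_⟩
    by_cases hD0 : D = 0
    · simp [hD0]
    have h1 := totalDegree_mul_of_isDomain (aux_sub_ne h) hD0
    have h2 := totalDegree_sub (X i * pderiv i P) (X j * pderiv j P)
    have h3 := aux_degX P i
    have h4 := aux_degX P j
    have h5 := aux_sub_deg h
    rw [hD, h1] at h2
    omega

/-- The operator `B₂` maps symmetric polynomials to symmetric polynomials, lowering the
total degree by at least one: for a symmetric polynomial `p` of total degree `d` there is a
symmetric polynomial `q` of total degree at most `d - 1` (with `q = 0` if `d < 1`) agreeing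
with `B₂p` at every point with pairwise distinct coordinates. -/
theorem opB2_maps_symmetric_polynomials (θ : ℝ) (hθ : 0 < θ) (k : ℕ) (hk : 1 ≤ k)
    (P : MvPolynomial (Fin k) ℝ) (hP : P.IsSymmetric) :
    ∃ Q : MvPolynomial (Fin k) ℝ, Q.IsSymmetric ∧
      Q.totalDegree ≤ P.totalDegree - 1 ∧
      (P.totalDegree < 1 → Q = 0) ∧
      ∀ z : Fin k → ℝ, Function.Injective z →
        opB2 θ (fun w => MvPolynomial.eval w P) z = MvPolynomial.eval z Q := by
  by_cases hd : P.totalDegree < 1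
  · refine ⟨0, MvPolynomial.IsSymmetric.zero, by simp, fun _ => rfl, fun z _ => ?_⟩
    have h := MvPolynomial.totalDegree_eq_zero_iff_eq_C.1 (Nat.lt_one_iff.1 hd)
    unfold opB2
    simp only [aux_pd, aux_pd2]
    rw [h]; simp
  choose D hD hD0 hDd using aux_D P hP
  have hpr : ∀ (e : Equiv.Perm (Fin k)) i (R : MvPolynomial (Fin k) ℝ),
      MvPolynomial.rename e (MvPolynomial.pderiv i R) =
        MvPolynomial.pderiv (e i) (MvPolynomial.rename e R) :=
    fun e i R => (MvPolynomial.pderiv_rename e.injective i R).symm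
  have hDe : ∀ (e : Equiv.Perm (Fin k)) i j, MvPolynomial.rename e (D i j) = D (e i) (e j) := by
    intro e i j
    by_cases h : i = j
    · rw [hD0 _ _ h, hD0 _ _ (congrArg e h), map_zero]
    · have h1 := congrArg (MvPolynomial.rename e) (hD i j)
      simp only [map_sub, map_mul, MvPolynomial.rename_X, hpr, hP e] at h1
      rw [hD] at h1
      exact (mul_left_cancel₀ (aux_sub_ne (fun h' => h (e.injective h'))) h1).symm
  refine ⟨(1 / 2 : ℝ) • ∑ i, MvPolynomial.X i * MvPolynomial.pderiv i (MvPolynomial.pderiv i P)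
    + (θ / 2) • ∑ i, ∑ j, D i j, ?_, ?_, fun h => absurd h hd, ?_⟩
  · refine (MvPolynomial.IsSymmetric.smul _ ?_).add (MvPolynomial.IsSymmetric.smul _ ?_)
    · intro e
      simp only [map_sum, map_mul, MvPolynomial.rename_X, hpr, hP e]
      exact Equiv.sum_comp e
        (fun i => MvPolynomial.X i * MvPolynomial.pderiv i (MvPolynomial.pderiv i P))
    · intro e
      simp only [map_sum, hDe]
      rw [Equiv.sum_comp e (fun i => ∑ j, D i (e j))]
      exact Finset.sum_congr rfl fun i _ => Equiv.sum_comp e (fun j => D i j)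
  · refine (MvPolynomial.totalDegree_add _ _).trans (max_le ?_ ?_)
    · refine (MvPolynomial.totalDegree_smul_le _ _).trans ?_
      exact MvPolynomial.totalDegree_finsetSum_le fun i _ => (aux_degX _ i).trans (aux_deg P i)
    · refine (MvPolynomial.totalDegree_smul_le _ _).trans ?_
      exact MvPolynomial.totalDegree_finsetSum_le fun i _ =>
        MvPolynomial.totalDegree_finsetSum_le fun j _ => hDd i j
  · intro z hz
    unfold opB2
    simp only [aux_pd, aux_pd2]
    simp only [map_add, MvPolynomial.smul_eval, map_sum, map_mul, MvPolynomial.eval_X]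
    set a : Fin k → ℝ := fun i => MvPolynomial.eval z (MvPolynomial.pderiv i P) with ha
    have h1 : ∀ i, ∑ j ∈ univ.erase i, (z i / (z i - z j)) * a i =
        ∑ j, (z i / (z i - z j)) * a i := by
      intro i
      apply Finset.sum_erase
      simp
    have h2 : ∀ i j, MvPolynomial.eval z (D i j) =
        (z i / (z i - z j)) * a i + (z j / (z j - z i)) * a j := by
      intro i j
      by_cases h : i = j
      · rw [hD0 _ _ h, h]; simp
      · have hne : z i - z j ≠ 0 := sub_ne_zero.2 fun h' => h (hz h')
        have hne' : z j - z i ≠ 0 := sub_ne_zero.2 fun h' => h (hz h').symm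
        have h3 := congrArg (MvPolynomial.eval z) (hD i j)
        simp only [map_sub, map_mul, MvPolynomial.eval_X] at h3
        apply mul_left_cancel₀ hne
        rw [← h3, ← neg_sub (z i) (z j)]
        simp only [ha]
        field_simp
        ring
    have h4 : ∑ i, ∑ j, MvPolynomial.eval z (D i j) =
        2 * ∑ i, ∑ j, (z i / (z i - z j)) * a i := by
      simp only [h2, Finset.sum_add_distrib]
      rw [Finset.sum_comm (f := fun i j => (z j / (z j - z i)) * a j)]
      ring
    have h5 : ∑ i, ∑ j ∈ univ.erase i, (z i / (z i - z j)) * a i =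
        ∑ i, ∑ j, (z i / (z i - z j)) * a i := Finset.sum_congr rfl fun i _ => h1 i
    rw [h4]
    simp only [ha] at h5 ⊢
    rw [h5]
    ring
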